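/- Let μ ∈ ℝ and σ > 0, and define the Gaussian expected-improvement function h_{μ,σ}(y) = (μ − y)·Φ((μ − y)/σ) + σ·φ((μ − y)/σ) for y ∈ ℝ. Then h_{μ,σ} is strictly decreasing on ℝ: for all y₁ < y₂, h_{μ,σ}(y₁) > h_{μ,σ}(y₂). -/

import Mathlib

/-- The standard normal density `φ(t) = (2π)^{-1/2} exp(−t²/2)`. -/
noncomputable def stdNormalPDF (t : ℝ) : ℝ :=
  (Real.sqrt (2 * Real.pi))⁻¹ * Real.exp (-t ^ 2 / 2)

/-- The standard normal cumulative distribution function `Φ(t) = ∫_{−∞}^t φ(s) ds`. -/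
noncomputable def stdNormalCDF (t : ℝ) : ℝ :=
  ∫ s in Set.Iio t, stdNormalPDF s

/-- The Gaussian expected-improvement function
`h_{μ,σ}(y) = (μ − y)·Φ((μ − y)/σ) + σ·φ((μ − y)/σ)`. -/
noncomputable def gaussianEI (μ σ y : ℝ) : ℝ :=
  (μ - y) * stdNormalCDF ((μ - y) / σ) + σ * stdNormalPDF ((μ - y) / σ)

open MeasureTheory

theorem stdNormalPDF_pos (t : ℝ) : 0 < stdNormalPDF t := by
  unfold stdNormalPDF
  positivity

theorem continuous_stdNormalPDF : Continuous stdNormalPDF := by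
  unfold stdNormalPDF
  fun_prop

theorem integrable_stdNormalPDF : Integrable stdNormalPDF := by
  have h := (integrable_exp_neg_mul_sq (b := 1 / 2) (by norm_num)).const_mul
    (Real.sqrt (2 * Real.pi))⁻¹
  refine h.congr (ae_of_all _ fun t => ?_)
  simp only [stdNormalPDF]
  ring_nf

theorem hasDerivAt_stdNormalPDF (t : ℝ) : HasDerivAt stdNormalPDF (-t * stdNormalPDF t) t := by
  have h := ((((hasDerivAt_id t).pow 2).neg.div_const 2).exp).const_mul (Real.sqrt (2 * Real.pi))⁻¹
  refine h.congr_deriv ?_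
  simp [stdNormalPDF]
  ring

theorem stdNormalCDF_pos (t : ℝ) : 0 < stdNormalCDF t := by
  have hsupp : Function.support stdNormalPDF = Set.univ :=
    Set.eq_univ_of_forall fun s => (stdNormalPDF_pos s).ne'
  rw [stdNormalCDF, setIntegral_pos_iff_support_of_nonneg_ae
    (ae_of_all _ fun s => (stdNormalPDF_pos s).le) integrable_stdNormalPDF.integrableOn]
  simp [hsupp]

theorem hasDerivAt_stdNormalCDF (t : ℝ) : HasDerivAt stdNormalCDF (stdNormalPDF t) t := by
  have hcdf : stdNormalCDF = fun u => stdNormalCDF 0 + ∫ s in (0 : ℝ)..u, stdNormalPDF s := by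
    funext u
    rw [← intervalIntegral.integral_Iic_sub_Iic integrable_stdNormalPDF.integrableOn
      integrable_stdNormalPDF.integrableOn]
    simp only [stdNormalCDF, integral_Iic_eq_integral_Iio]
    ring
  rw [hcdf]
  exact (continuous_stdNormalPDF.integral_hasStrictDerivAt 0 t).hasDerivAt.const_add _

/-- The function `t ↦ t Φ(t) + φ(t)` has derivative `Φ`, which is positive. -/
theorem strictMono_mul_stdNormalCDF_add_stdNormalPDF :
    StrictMono fun t => t * stdNormalCDF t + stdNormalPDF t := by
  refine strictMono_of_hasDerivAt_pos (f' := stdNormalCDF) (fun t => ?_) stdNormalCDF_pos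
  refine (((hasDerivAt_id t).mul (hasDerivAt_stdNormalCDF t)).add
    (hasDerivAt_stdNormalPDF t)).congr_deriv ?_
  simp

theorem gaussianEI_eq_mul {σ : ℝ} (hσ : σ ≠ 0) (μ y : ℝ) :
    gaussianEI μ σ y =
      σ * ((μ - y) / σ * stdNormalCDF ((μ - y) / σ) + stdNormalPDF ((μ - y) / σ)) := by
  rw [gaussianEI, mul_add, ← mul_assoc, mul_div_cancel₀ _ hσ]

/-- The Gaussian expected-improvement function `h_{μ,σ}` is strictly decreasing on `ℝ`. -/
theorem gaussianEI_strictAnti (μ σ : ℝ) (hσ : 0 < σ) :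
    ∀ y₁ y₂ : ℝ, y₁ < y₂ → gaussianEI μ σ y₁ > gaussianEI μ σ y₂ := by
  intro y₁ y₂ hy
  rw [gaussianEI_eq_mul hσ.ne', gaussianEI_eq_mul hσ.ne']
  have hlt : (μ - y₂) / σ < (μ - y₁) / σ := by gcongr
  exact mul_lt_mul_of_pos_left (strictMono_mul_stdNormalCDF_add_stdNormalPDF hlt) hσ
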